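/- Let ε > 0 and Θ_ε = {φ in F : D_{c,N}(P_φ ‖ Θ) < ε}, a set containing the indices of Θ. Let λ in [0,1], let π_0 be a prior supported on Θ_ε, let π_1 be a prior supported on the complement F \ Θ_ε (which is assumed nonempty if λ > 0), and set π = λ π_1 + (1−λ) π_0. Then J(π) ≤ λ R*_N(Θ, Φ) + (1−λ) R*_N(Θ, Θ_ε) + h(λ), where R*_N(Θ, Θ_ε) is the min-max regret with the data-generating family restricted to {P_φ : φ in Θ_ε} and h(λ) = −λ log λ − (1−λ) log(1−λ) is the binary entropy (with h(0) = h(1) = 0). -/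

import Mathlib

noncomputable section

/-- A model: a strictly positive probability function on `Y^(n+1)`. -/
def IsModel {Y : Type*} [Fintype Y] {n : ℕ} (P : (Fin (n + 1) → Y) → ℝ) : Prop :=
  (∀ y, 0 < P y) ∧ (∑ y, P y) = 1

/-- A predictor: to every prefix `y^{N-1}` it assigns a strictly positive
probability function on `Y`. -/
def IsPredictor {Y : Type*} [Fintype Y] {n : ℕ} (Q : (Fin n → Y) → Y → ℝ) : Prop :=
  ∀ z, (∀ y, 0 < Q z y) ∧ (∑ y, Q z y) = 1

/-- Marginal probability `P(y^{N-1}) = Σ_y P(y^{N-1}, y)` of a prefix. -/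
def prefixProb {Y : Type*} [Fintype Y] {n : ℕ} (P : (Fin (n + 1) → Y) → ℝ)
    (z : Fin n → Y) : ℝ :=
  ∑ y : Y, P (Fin.snoc z y)

/-- Conditional probability `P(y_N | y^{N-1}) = P(y^N) / P(y^{N-1})`. -/
def condProb {Y : Type*} [Fintype Y] {n : ℕ} (P : (Fin (n + 1) → Y) → ℝ)
    (y : Fin (n + 1) → Y) : ℝ :=
  P y / prefixProb P (Fin.init y)

/-- The regret
`R_N(Pφ, Pθ, Q) = Σ_{y^N} Pφ(y^N) log( Pθ(y_N|y^{N-1}) / Q(y_N|y^{N-1}) )`. -/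
def regretN {Y : Type*} [Fintype Y] {n : ℕ} (Pφ Pθ : (Fin (n + 1) → Y) → ℝ)
    (Q : (Fin n → Y) → Y → ℝ) : ℝ :=
  ∑ y, Pφ y * Real.log (condProb Pθ y / Q (Fin.init y) (y (Fin.last n)))

/-- Conditional KL divergence of a model `P` from a predictor `Q`. -/
def DcPred {Y : Type*} [Fintype Y] {n : ℕ} (P : (Fin (n + 1) → Y) → ℝ)
    (Q : (Fin n → Y) → Y → ℝ) : ℝ :=
  ∑ y, P y * Real.log (condProb P y / Q (Fin.init y) (y (Fin.last n)))

/-- Conditional KL divergence of a model `P` from another model `P'`. -/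
def DcModel {Y : Type*} [Fintype Y] {n : ℕ} (P P' : (Fin (n + 1) → Y) → ℝ) : ℝ :=
  ∑ y, P y * Real.log (condProb P y / condProb P' y)

/-- A prior: a probability vector on the index set `F`. -/
def IsPrior {F : Type*} [Fintype F] (π : F → ℝ) : Prop :=
  (∀ φ, 0 ≤ π φ) ∧ (∑ φ, π φ) = 1

/-- Conditional divergence of a model from the hypothesis class
`Θ = {P θ : θ ∈ G}`: the minimum over `θ ∈ G` of `D_{c,N}(P ‖ P θ)`. -/
def DcSet {Y F : Type*} [Fintype Y] [Fintype F] {n : ℕ}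
    (P : F → (Fin (n + 1) → Y) → ℝ) (G : Finset F) (hG : G.Nonempty)
    (Pφ : (Fin (n + 1) → Y) → ℝ) : ℝ :=
  G.inf' hG fun θ => DcModel Pφ (P θ)

/-- The mixture predictor
`Q_π(y_N | y^{N-1}) = (Σ_φ π(φ) P_φ(y^N)) / (Σ_φ π(φ) P_φ(y^{N-1}))`. -/
def mixPred {Y F : Type*} [Fintype Y] [Fintype F] {n : ℕ}
    (P : F → (Fin (n + 1) → Y) → ℝ) (π : F → ℝ) : (Fin n → Y) → Y → ℝ :=
  fun z y => (∑ φ, π φ * P φ (Fin.snoc z y)) / (∑ φ, π φ * prefixProb (P φ) z)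

/-- `I_π(Y_N; Φ | Y^{N-1})`. -/
def mutualInfoN {Y F : Type*} [Fintype Y] [Fintype F] {n : ℕ}
    (P : F → (Fin (n + 1) → Y) → ℝ) (π : F → ℝ) : ℝ :=
  ∑ φ, ∑ y, π φ * P φ y *
    Real.log (condProb (P φ) y / mixPred P π (Fin.init y) (y (Fin.last n)))

/-- `J(π) = I_π(Y_N; Φ | Y^{N-1}) − Σ_φ π(φ) D_{c,N}(P_φ ‖ Θ)`. -/
def Jfun {Y F : Type*} [Fintype Y] [Fintype F] {n : ℕ}
    (P : F → (Fin (n + 1) → Y) → ℝ) (G : Finset F) (hG : G.Nonempty)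
    (π : F → ℝ) : ℝ :=
  mutualInfoN P π - ∑ φ, π φ * DcSet P G hG (P φ)

/-- The min-max regret
`R*_N(Θ, Φ) = inf_Q max_{φ ∈ F} max_{θ ∈ G} R_N(P_φ, P_θ, Q)`. -/
def Rstar {Y F : Type*} [Fintype Y] [Fintype F] [Nonempty F] {n : ℕ}
    (P : F → (Fin (n + 1) → Y) → ℝ) (G : Finset F) (hG : G.Nonempty) : ℝ :=
  sInf {r : ℝ | ∃ Q, IsPredictor Q ∧
    r = Finset.univ.sup' Finset.univ_nonempty fun φ =>
          G.sup' hG fun θ => regretN (P φ) (P θ) Q}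

/-- The conditional capacity `C_{c,N}(Φ) = sup_π I_π(Y_N; Φ | Y^{N-1})`. -/
def capacityN {Y F : Type*} [Fintype Y] [Fintype F] {n : ℕ}
    (P : F → (Fin (n + 1) → Y) → ℝ) : ℝ :=
  sSup {r : ℝ | ∃ π, IsPrior π ∧ r = mutualInfoN P π}

/-- The binary entropy `h(λ) = −λ log λ − (1−λ) log(1−λ)`
(with `h(0) = h(1) = 0`, using `Real.log 0 = 0`). -/
def binEnt (l : ℝ) : ℝ := -(l * Real.log l) - (1 - l) * Real.log (1 - l)

/-- The min-max regret with the data-generating family restricted to indices in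
`S` (and hypothesis class `Θ = {P θ : θ ∈ G}`):
`R*_N(Θ, S) = inf_Q max_{φ ∈ S} max_{θ ∈ G} R_N(P_φ, P_θ, Q)`. -/
def RstarOn {Y F : Type*} [Fintype Y] [Fintype F] {n : ℕ}
    (P : F → (Fin (n + 1) → Y) → ℝ) (G : Finset F) (S : Finset F) : ℝ :=
  sInf {r : ℝ | ∃ Q, IsPredictor Q ∧
    r = sSup {x : ℝ | ∃ φ ∈ S, ∃ θ ∈ G, x = regretN (P φ) (P θ) Q}}

section

variable {Y F : Type*} [Fintype Y] [Fintype F] {n : ℕ}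

lemma sum_eq_sum_snoc (f : (Fin (n + 1) → Y) → ℝ) :
    ∑ y, f y = ∑ z : Fin n → Y, ∑ a : Y, f (Fin.snoc z a) := by
  rw [← Fintype.sum_prod_type', ← (Fin.snocEquiv fun _ : Fin (n + 1) => Y).sum_comp,
    ← (Equiv.prodComm (Fin n → Y) Y).sum_comp]
  rfl

lemma IsModel.prefixProb_pos [Nonempty Y] {P : (Fin (n + 1) → Y) → ℝ} (hP : IsModel P)
    (z : Fin n → Y) : 0 < prefixProb P z :=
  Finset.sum_pos (fun _ _ => hP.1 _) Finset.univ_nonempty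

lemma IsModel.condProb_pos [Nonempty Y] {P : (Fin (n + 1) → Y) → ℝ} (hP : IsModel P)
    (y : Fin (n + 1) → Y) : 0 < condProb P y :=
  div_pos (hP.1 y) (hP.prefixProb_pos _)

lemma exists_isPredictor [Nonempty Y] :
    ∃ Q : (Fin n → Y) → Y → ℝ, IsPredictor Q := by
  refine ⟨fun _ _ => (Fintype.card Y : ℝ)⁻¹, fun _ => ⟨fun _ => by positivity, ?_⟩⟩
  simp

lemma IsPrior.sum_mul_pos {π : F → ℝ} (hπ : IsPrior π) {f : F → ℝ} (hf : ∀ φ, 0 < f φ) :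
    0 < ∑ φ, π φ * f φ := by
  obtain ⟨φ, -, hφ⟩ : ∃ φ ∈ Finset.univ, π φ ≠ 0 :=
    Finset.exists_ne_zero_of_sum_ne_zero (by rw [hπ.2]; exact one_ne_zero)
  exact Finset.sum_pos' (fun ψ _ => mul_nonneg (hπ.1 ψ) (hf ψ).le)
    ⟨φ, Finset.mem_univ φ, mul_pos ((hπ.1 φ).lt_of_ne' hφ) (hf φ)⟩

lemma IsPrior.mix {π π' : F → ℝ} (hπ : IsPrior π) (hπ' : IsPrior π') {l : ℝ}
    (hl0 : 0 ≤ l) (hl1 : l ≤ 1) : IsPrior fun φ => l * π φ + (1 - l) * π' φ := by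
  refine ⟨fun φ => add_nonneg (mul_nonneg hl0 (hπ.1 φ))
    (mul_nonneg (sub_nonneg.2 hl1) (hπ'.1 φ)), ?_⟩
  rw [Finset.sum_add_distrib, ← Finset.mul_sum, ← Finset.mul_sum, hπ.2, hπ'.2]
  ring

lemma IsPredictor.mix {Q Q' : (Fin n → Y) → Y → ℝ} (hQ : IsPredictor Q)
    (hQ' : IsPredictor Q') {l : ℝ} (hl0 : 0 ≤ l) (hl1 : l ≤ 1) :
    IsPredictor fun z a => l * Q z a + (1 - l) * Q' z a := by
  refine fun z => ⟨fun a => ?_, ?_⟩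
  · rcases hl0.eq_or_lt with rfl | hl
    · simpa using (hQ' z).1 a
    · exact add_pos_of_pos_of_nonneg (mul_pos hl ((hQ z).1 a))
        (mul_nonneg (sub_nonneg.2 hl1) ((hQ' z).1 a).le)
  · rw [Finset.sum_add_distrib, ← Finset.mul_sum, ← Finset.mul_sum, (hQ z).2, (hQ' z).2]
    ring

/-- The mixture predictor minimizes the `π`-average conditional divergence. -/
lemma mutualInfoN_le_sum_DcPred [Nonempty Y] {P : F → (Fin (n + 1) → Y) → ℝ}
    (hP : ∀ φ, IsModel (P φ)) {π : F → ℝ} (hπ : IsPrior π) {Q : (Fin n → Y) → Y → ℝ}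
    (hQ : IsPredictor Q) : mutualInfoN P π ≤ ∑ φ, π φ * DcPred (P φ) Q := by
  have hterm : ∀ z a,
      ∑ φ, π φ * (P φ (Fin.snoc z a) *
        Real.log (condProb (P φ) (Fin.snoc z a) / mixPred P π z a)) ≤
      ∑ φ, π φ * (P φ (Fin.snoc z a) *
        Real.log (condProb (P φ) (Fin.snoc z a) / Q z a)) +
      ((∑ φ, π φ * prefixProb (P φ) z) * Q z a - ∑ φ, π φ * P φ (Fin.snoc z a)) := by
    intro z a
    have hm : 0 < ∑ φ, π φ * P φ (Fin.snoc z a) := hπ.sum_mul_pos fun φ => (hP φ).1 _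
    have hz : 0 < ∑ φ, π φ * prefixProb (P φ) z := hπ.sum_mul_pos fun φ => (hP φ).prefixProb_pos z
    have hq : 0 < Q z a := (hQ z).1 a
    have hmix : 0 < mixPred P π z a := div_pos hm hz
    have hlog := mul_le_mul_of_nonneg_left (Real.log_le_sub_one_of_pos (div_pos hq hmix)) hm.le
    have hsplit : ∀ φ, π φ * (P φ (Fin.snoc z a) *
        Real.log (condProb (P φ) (Fin.snoc z a) / mixPred P π z a)) =
        π φ * (P φ (Fin.snoc z a) * Real.log (condProb (P φ) (Fin.snoc z a) / Q z a)) +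
        π φ * P φ (Fin.snoc z a) * Real.log (Q z a / mixPred P π z a) := by
      intro φ
      have hc := (hP φ).condProb_pos (Fin.snoc z a)
      rw [Real.log_div hc.ne' hmix.ne', Real.log_div hc.ne' hq.ne', Real.log_div hq.ne' hmix.ne']
      ring
    rw [Finset.sum_congr rfl fun φ _ => hsplit φ, Finset.sum_add_distrib, ← Finset.sum_mul]
    refine add_le_add_right (hlog.trans_eq ?_) _
    rw [mixPred]
    field_simp
  have htotal : ∑ z : Fin n → Y, ∑ a : Y,
      ((∑ φ, π φ * prefixProb (P φ) z) * Q z a - ∑ φ, π φ * P φ (Fin.snoc z a)) = 0 := by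
    refine Finset.sum_eq_zero fun z _ => ?_
    rw [Finset.sum_sub_distrib, ← Finset.mul_sum, (hQ z).2, mul_one, Finset.sum_comm, sub_eq_zero]
    simp only [prefixProb, Finset.mul_sum]
  calc mutualInfoN P π
      = ∑ z : Fin n → Y, ∑ a : Y, ∑ φ, π φ * (P φ (Fin.snoc z a) *
          Real.log (condProb (P φ) (Fin.snoc z a) / mixPred P π z a)) := by
        rw [mutualInfoN, Finset.sum_comm, sum_eq_sum_snoc]
        simp only [Fin.init_snoc, Fin.snoc_last, mul_assoc]
    _ ≤ ∑ z : Fin n → Y, ∑ a : Y, (∑ φ, π φ * (P φ (Fin.snoc z a) *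
          Real.log (condProb (P φ) (Fin.snoc z a) / Q z a)) +
          ((∑ φ, π φ * prefixProb (P φ) z) * Q z a - ∑ φ, π φ * P φ (Fin.snoc z a))) :=
        Finset.sum_le_sum fun z _ => Finset.sum_le_sum fun a _ => hterm z a
    _ = ∑ φ, π φ * DcPred (P φ) Q := by
        simp only [Finset.sum_add_distrib (s := (Finset.univ : Finset Y)),
          Finset.sum_add_distrib (s := (Finset.univ : Finset (Fin n → Y))), htotal, add_zero,
          DcPred, Finset.mul_sum]
        symm
        rw [Finset.sum_comm, sum_eq_sum_snoc]
        simp only [Fin.init_snoc, Fin.snoc_last]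

lemma mul_DcPred_le_of_mul_le [Nonempty Y] {P : (Fin (n + 1) → Y) → ℝ} (hP : IsModel P)
    {Q Q' : (Fin n → Y) → Y → ℝ} (hQ : IsPredictor Q) (hQ' : IsPredictor Q') {c : ℝ}
    (hc : 0 ≤ c) (h : ∀ z a, c * Q' z a ≤ Q z a) :
    c * DcPred P Q ≤ c * (DcPred P Q' - Real.log c) := by
  rcases hc.eq_or_lt with rfl | hc
  · simp
  refine mul_le_mul_of_nonneg_left ?_ hc.le
  rw [DcPred, DcPred, ← one_mul (Real.log c), ← hP.2, Finset.sum_mul, ← Finset.sum_sub_distrib]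
  refine Finset.sum_le_sum fun y _ => ?_
  have hq := (hQ (Fin.init y)).1 (y (Fin.last n))
  have hq' := (hQ' (Fin.init y)).1 (y (Fin.last n))
  have hlog := Real.log_le_log (mul_pos hc hq') (h (Fin.init y) (y (Fin.last n)))
  rw [Real.log_mul hc.ne' hq'.ne'] at hlog
  rw [← mul_sub, Real.log_div (hP.condProb_pos y).ne' hq.ne',
    Real.log_div (hP.condProb_pos y).ne' hq'.ne']
  exact mul_le_mul_of_nonneg_left (by linarith) (hP.1 y).le

lemma DcPred_sub_DcModel [Nonempty Y] {P P' : (Fin (n + 1) → Y) → ℝ} (hP : IsModel P)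
    (hP' : IsModel P') {Q : (Fin n → Y) → Y → ℝ} (hQ : IsPredictor Q) :
    DcPred P Q - DcModel P P' = regretN P P' Q := by
  rw [DcPred, DcModel, regretN, ← Finset.sum_sub_distrib]
  refine Finset.sum_congr rfl fun y _ => ?_
  have hq := (hQ (Fin.init y)).1 (y (Fin.last n))
  rw [Real.log_div (hP.condProb_pos y).ne' hq.ne', Real.log_div (hP'.condProb_pos y).ne' hq.ne',
    Real.log_div (hP.condProb_pos y).ne' (hP'.condProb_pos y).ne']
  ring

lemma DcPred_sub_DcSet_le_sSup [Nonempty Y] {P : F → (Fin (n + 1) → Y) → ℝ}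
    (hP : ∀ φ, IsModel (P φ)) {G : Finset F} (hG : G.Nonempty) {S : Finset F} {φ : F}
    (hφ : φ ∈ S) {Q : (Fin n → Y) → Y → ℝ} (hQ : IsPredictor Q) :
    DcPred (P φ) Q - DcSet P G hG (P φ) ≤
      sSup {x : ℝ | ∃ φ ∈ S, ∃ θ ∈ G, x = regretN (P φ) (P θ) Q} := by
  obtain ⟨θ, hθ, h⟩ := Finset.exists_mem_eq_inf' hG fun θ => DcModel (P φ) (P θ)
  rw [DcSet, h, DcPred_sub_DcModel (hP φ) (hP θ) hQ]
  refine le_csSup (Set.Finite.bddAbove ?_) ⟨φ, hφ, θ, hθ, rfl⟩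
  refine (Set.finite_range fun p : F × F => regretN (P p.1) (P p.2) Q).subset ?_
  rintro x ⟨ψ, -, θ', -, rfl⟩
  exact ⟨(ψ, θ'), rfl⟩

lemma sum_mul_DcPred_sub_DcSet_le_sSup [Nonempty Y] {P : F → (Fin (n + 1) → Y) → ℝ}
    (hP : ∀ φ, IsModel (P φ)) {G : Finset F} (hG : G.Nonempty) {S : Finset F} {π : F → ℝ}
    (hπ : IsPrior π) (hS : ∀ φ ∉ S, π φ = 0) {Q : (Fin n → Y) → Y → ℝ} (hQ : IsPredictor Q) :
    ∑ φ, π φ * (DcPred (P φ) Q - DcSet P G hG (P φ)) ≤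
      sSup {x : ℝ | ∃ φ ∈ S, ∃ θ ∈ G, x = regretN (P φ) (P θ) Q} := by
  rw [← one_mul (sSup _), ← hπ.2, Finset.sum_mul]
  refine Finset.sum_le_sum fun φ _ => ?_
  by_cases hφ : φ ∈ S
  · exact mul_le_mul_of_nonneg_left (DcPred_sub_DcSet_le_sSup hP hG hφ hQ) (hπ.1 φ)
  · simp [hS φ hφ]

/-- Mixing the predictors `Q1` and `Q0` with weights `l` and `1 - l` costs at most the binary
entropy of `l`. -/
lemma Jfun_mix_le [Nonempty Y] {P : F → (Fin (n + 1) → Y) → ℝ}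
    (hP : ∀ φ, IsModel (P φ)) {G : Finset F} (hG : G.Nonempty) {l : ℝ} (hl0 : 0 ≤ l)
    (hl1 : l ≤ 1) {π0 π1 : F → ℝ} (hπ0 : IsPrior π0) (hπ1 : IsPrior π1)
    {Q0 Q1 : (Fin n → Y) → Y → ℝ} (hQ0 : IsPredictor Q0) (hQ1 : IsPredictor Q1) :
    Jfun P G hG (fun φ => l * π1 φ + (1 - l) * π0 φ) ≤
      l * ∑ φ, π1 φ * (DcPred (P φ) Q1 - DcSet P G hG (P φ)) +
        (1 - l) * ∑ φ, π0 φ * (DcPred (P φ) Q0 - DcSet P G hG (P φ)) + binEnt l := by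
  have hl1' := sub_nonneg.2 hl1
  have hQ := hQ1.mix hQ0 hl0 hl1
  refine (sub_le_sub_right (mutualInfoN_le_sum_DcPred hP (hπ1.mix hπ0 hl0 hl1) hQ) _).trans ?_
  have hent : binEnt l = ∑ φ, (π1 φ * -(l * Real.log l) +
      π0 φ * -((1 - l) * Real.log (1 - l))) := by
    rw [Finset.sum_add_distrib, ← Finset.sum_mul, ← Finset.sum_mul, hπ1.2, hπ0.2, binEnt]
    ring
  rw [hent, Finset.mul_sum, Finset.mul_sum, ← Finset.sum_add_distrib, ← Finset.sum_add_distrib,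
    ← Finset.sum_sub_distrib]
  refine Finset.sum_le_sum fun φ _ => ?_
  have h1 := mul_le_mul_of_nonneg_left (mul_DcPred_le_of_mul_le (hP φ) hQ hQ1 hl0 fun z a =>
    le_add_of_nonneg_right (mul_nonneg hl1' ((hQ0 z).1 a).le)) (hπ1.1 φ)
  have h0 := mul_le_mul_of_nonneg_left (mul_DcPred_le_of_mul_le (hP φ) hQ hQ0 hl1' fun z a =>
    le_add_of_nonneg_left (mul_nonneg hl0 ((hQ1 z).1 a).le)) (hπ0.1 φ)
  linarith

lemma le_mul_sInf {A : Set ℝ} (hA : A.Nonempty) {c l : ℝ} (hl : 0 ≤ l)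
    (h : ∀ a ∈ A, c ≤ l * a) : c ≤ l * sInf A := by
  rw [← smul_eq_mul, ← Real.sInf_smul_of_nonneg hl]
  refine le_csInf hA.smul_set ?_
  rintro _ ⟨a, ha, rfl⟩
  exact h a ha

end

variable {Y F : Type*} [Fintype Y] [Nonempty Y] [Fintype F] [Nonempty F] {n : ℕ}

/-- for `π = λ π_1 + (1−λ) π_0` with `π_0` supported on
`Θ_ε = {φ : D_{c,N}(P_φ ‖ Θ) < ε}` and `π_1` supported on its complement,
`J(π) ≤ λ R*_N(Θ, Φ) + (1−λ) R*_N(Θ, Θ_ε) + h(λ)`. -/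
theorem J_le_lambda_decomposition
    (P : F → (Fin (n + 1) → Y) → ℝ) (hP : ∀ φ, IsModel (P φ))
    (G : Finset F) (hG : G.Nonempty)
    (ε : ℝ) (hε : 0 < ε)
    (l : ℝ) (hl0 : 0 ≤ l) (hl1 : l ≤ 1)
    (π0 π1 : F → ℝ) (hπ0 : IsPrior π0) (hπ1 : IsPrior π1)
    (hπ0supp : ∀ φ ∉ Finset.univ.filter (fun φ => DcSet P G hG (P φ) < ε), π0 φ = 0)
    (hπ1supp : ∀ φ ∈ Finset.univ.filter (fun φ => DcSet P G hG (P φ) < ε), π1 φ = 0) :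
    Jfun P G hG (fun φ => l * π1 φ + (1 - l) * π0 φ) ≤
      l * RstarOn P G Finset.univ +
        (1 - l) * RstarOn P G (Finset.univ.filter fun φ => DcSet P G hG (P φ) < ε) +
        binEnt l := by
  obtain ⟨Q, hQ⟩ := exists_isPredictor (Y := Y) (n := n)
  have hl1' := sub_nonneg.2 hl1
  rw [RstarOn, RstarOn, ← sub_le_iff_le_add, ← sub_le_iff_le_add]
  refine le_mul_sInf (by exact ⟨_, Q, hQ, rfl⟩) hl0 ?_
  rintro _ ⟨Q1, hQ1, rfl⟩
  rw [sub_le_comm]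
  refine le_mul_sInf (by exact ⟨_, Q, hQ, rfl⟩) hl1' ?_
  rintro _ ⟨Q0, hQ0, rfl⟩
  have h1 := mul_le_mul_of_nonneg_left (sum_mul_DcPred_sub_DcSet_le_sSup hP hG hπ1
    (fun φ hφ => absurd (Finset.mem_univ φ) hφ) hQ1) hl0
  have h0 := mul_le_mul_of_nonneg_left
    (sum_mul_DcPred_sub_DcSet_le_sSup hP hG hπ0 hπ0supp hQ0) hl1'
  have := Jfun_mix_le hP hG hl0 hl1 hπ0 hπ1 hQ0 hQ1
  linarith
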